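/- Let i, k ≥ 3 and p ≥ 0 be integers with r = ⌊(F_i − 1)/F_k⌋ ≥ p. Then the p-Sylvester number satisfies n_p(F_i, F_{i+2}, F_{i+k}) = ((F_i + 2p·F_k − 1)·F_{i+2} − F_i + 1)/2 − (2r·F_i − (r+p+1)(r−p)·F_k)·F_{k−2}/2. -/

import Mathlib

/-- Number of representations of `n` as a nonnegative integer combination of `a`, `b`, `c`. -/
noncomputable def repCount (a b c : ℕ) (n : ℤ) : ℕ :=
  Nat.card {v : ℕ × ℕ × ℕ // (v.1 : ℤ) * a + v.2.1 * b + v.2.2 * c = n}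

/-- `g` is the `p`-Frobenius number of `a, b, c`: the largest integer with at most `p`
representations. -/
def IsPFrob (p a b c : ℕ) (g : ℤ) : Prop :=
  IsGreatest {n : ℤ | repCount a b c n ≤ p} g

/-- Lucas numbers. -/
def lucas : ℕ → ℕ
  | 0 => 2
  | 1 => 1
  | n + 2 => lucas n + lucas (n + 1)

/-- The rank threshold in the residue class of `j * b` modulo `a`. -/
def thr (a b K s p j : ℕ) : ℤ :=
  if p * K ≤ j then -(s : ℤ) * (((j / K : ℕ) : ℤ) - p)
  else (b : ℤ) - s * ((((j + a) / K : ℕ) : ℤ) - p + ((j / K : ℕ) : ℤ) + 1)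

/-- Pairs parametrizing the representations. -/
def WSet (a b K s j : ℕ) (N : ℤ) : Set (ℕ × ℕ) :=
  {v | K * v.2 ≤ j + v.1 * a ∧ ((v.1 * b : ℕ) : ℤ) - ((s * v.2 : ℕ) : ℤ) ≤ N}

theorem bound_sz {a K s j m z : ℕ} (hs : 2 * s ≤ K) (hj : j < a)
    (h : K * z ≤ j + m * a) : 2 * (s * z) < (m + 1) * a := by
  have : 2 * s * z ≤ K * z := Nat.mul_le_mul_right _ hs
  nlinarith

theorem WSet_finite {a b K s j : ℕ} (N : ℤ) (hs : 2 * s ≤ K) (hK : 1 ≤ K) (hj : j < a)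
    (hab : 3 * a ≤ 2 * b) : (WSet a b K s j N).Finite := by
  have ha : 1 ≤ a := by omega
  apply Set.Finite.subset (Finset.finite_toSet
    ((Finset.range (2 * N.toNat + 2)) ×ˢ (Finset.range (j + (2 * N.toNat + 2) * a + 1))))
  rintro ⟨m, z⟩ ⟨h1, h2⟩
  simp only at h1 h2
  have h3 := bound_sz hs hj h1
  have hm : m < 2 * N.toNat + 2 := by
    by_contra hcon
    push Not at hcon
    have hN : N ≤ N.toNat := Int.self_le_toNat N
    have h5 : m * b ≤ N.toNat + s * z := by zify at *; linarith
    have h6 : m * (3 * a) ≤ m * (2 * b) := Nat.mul_le_mul_left _ hab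
    have h7 : 2 * N.toNat + 2 ≤ m * a := le_trans hcon (Nat.le_mul_of_pos_right _ ha)
    have h8 : m * a ≥ 2 * a := Nat.mul_le_mul_right _ (by omega)
    nlinarith
  simp only [Finset.coe_product, Set.mem_prod, Finset.coe_range, Set.mem_Iio]
  refine ⟨hm, ?_⟩
  have : z ≤ K * z := Nat.le_mul_of_pos_left _ hK
  have : m * a ≤ (2 * N.toNat + 2) * a := Nat.mul_le_mul_right _ hm.le
  omega

theorem WSet_card {a b K s p j : ℕ} (N : ℤ) (hs : 2 * s ≤ K) (hs1 : 1 ≤ s) (hj : j < a)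
    (hab : 3 * a ≤ 2 * b) (hp : p * K < a) :
    (WSet a b K s j N).ncard ≤ p ↔ N < thr a b K s p j := by
  have hK : 1 ≤ K := by omega
  have ha : 1 ≤ a := by omega
  have hfin := WSet_finite N hs hK hj hab
  have hKq := Nat.div_mul_le_self j K
  have hKq' : ∀ z, K * z ≤ j ↔ z ≤ j / K := fun z => by
    rw [Nat.le_div_iff_mul_le hK, mul_comm]
  have hKQ' : ∀ z, K * z ≤ j + a ↔ z ≤ (j + a) / K := fun z => by
    rw [Nat.le_div_iff_mul_le hK, mul_comm]
  have hpq : p * K ≤ j ↔ p ≤ j / K := (Nat.le_div_iff_mul_le hK).symm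
  have hQp : p ≤ (j + a) / K := by rw [Nat.le_div_iff_mul_le hK]; omega
  set q := j / K with hq
  set Q := (j + a) / K with hQ
  have hs0 : (0 : ℤ) < s := by exact_mod_cast hs1
  clear_value q Q
  have hQb : s * Q < b := by
    have := bound_sz (m := 1) hs hj (by rw [one_mul]; exact (hKQ' Q).2 le_rfl)
    omega
  -- values for m ≥ 1 and m ≥ 2
  have hm1 : ∀ m z, 1 ≤ m → K * z ≤ j + m * a → s * z < m * b := fun m z hm h => by
    have := bound_sz hs hj h
    nlinarith
  have hm2 : ∀ m z, 2 ≤ m → K * z ≤ j + m * a → b + s * z < m * b := fun m z hm h => by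
    have := bound_sz hs hj h
    obtain ⟨d, rfl⟩ := Nat.exists_eq_add_of_le hm
    nlinarith
  constructor
  · -- contrapositive: many representations
    intro h
    by_contra hN
    push Not at hN
    unfold thr at hN
    by_cases hc : p * K ≤ j
    · rw [if_pos hc, ← hq] at hN
      have hpq1 := hpq.1 hc
      have hsub : (((Finset.Icc (q - p) q).image (fun z => ((0 : ℕ), z)) : Finset (ℕ × ℕ)) :
          Set (ℕ × ℕ)) ⊆ WSet a b K s j N := by
        intro v hv
        simp only [Finset.coe_image, Set.mem_image, Finset.coe_Icc, Set.mem_Icc] at hv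
        obtain ⟨z, ⟨hz1, hz2⟩, rfl⟩ := hv
        refine ⟨by simpa using (hKq' z).2 hz2, ?_⟩
        push_cast
        have : (q : ℤ) - p ≤ z := by omega
        nlinarith
      have := Set.ncard_le_ncard hsub hfin
      rw [Set.ncard_coe_finset, Finset.card_image_of_injective _ (Prod.mk_right_injective 0),
        Nat.card_Icc] at this
      omega
    · rw [if_neg hc, ← hq, ← hQ] at hN
      have hpq1 : q < p := by rw [hpq] at hc; omega
      have hN0 : 0 ≤ N := by
        have h1 : (s : ℤ) * Q < b := by exact_mod_cast hQb
        have h2 : (q : ℤ) + 1 ≤ p := by exact_mod_cast hpq1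
        nlinarith
      have hsub : (((Finset.Icc 0 q).image (fun z => ((0 : ℕ), z)) ∪
          (Finset.Icc (Q - (p - q - 1)) Q).image (fun z => ((1 : ℕ), z)) : Finset (ℕ × ℕ)) :
          Set (ℕ × ℕ)) ⊆ WSet a b K s j N := by
        intro v hv
        simp only [Finset.coe_union, Set.mem_union, Finset.coe_image, Set.mem_image,
          Finset.coe_Icc, Set.mem_Icc] at hv
        obtain ⟨z, ⟨hz1, hz2⟩, rfl⟩ | ⟨z, ⟨hz1, hz2⟩, rfl⟩ := hv
        · refine ⟨by simpa using (hKq' z).2 hz2, ?_⟩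
          push_cast
          have : 0 ≤ (s : ℤ) * z := by positivity
          linarith
        · refine ⟨by simpa using (hKQ' z).2 hz2, ?_⟩
          push_cast
          have : (Q : ℤ) - p + q + 1 ≤ z := by omega
          nlinarith
      have := Set.ncard_le_ncard hsub hfin
      rw [Set.ncard_coe_finset, Finset.card_union_of_disjoint,
        Finset.card_image_of_injective _ (Prod.mk_right_injective 0),
        Finset.card_image_of_injective _ (Prod.mk_right_injective 1),
        Nat.card_Icc, Nat.card_Icc] at this
      · omega
      · rw [Finset.disjoint_left]
        rintro v hv hv'
        simp only [Finset.mem_image] at hv hv'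
        obtain ⟨z, -, rfl⟩ := hv
        obtain ⟨z', -, h'⟩ := hv'
        simp at h'
  · intro hN
    unfold thr at hN
    by_cases hc : p * K ≤ j
    · rw [if_pos hc, ← hq] at hN
      have hpq1 := hpq.1 hc
      have hsub : WSet a b K s j N ⊆
          (((Finset.Ioc (q - p) q).image (fun z => ((0 : ℕ), z)) : Finset (ℕ × ℕ)) :
          Set (ℕ × ℕ)) := by
        rintro ⟨m, z⟩ ⟨h1, h2⟩
        simp only at h1 h2
        have hNneg : N < 0 := by
          have : (p : ℤ) ≤ q := by exact_mod_cast hpq1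
          nlinarith
        have hm : m = 0 := by
          by_contra hm
          have := hm1 m z (by omega) h1
          omega
        subst hm
        simp only [Finset.coe_image, Set.mem_image, Finset.coe_Ioc, Set.mem_Ioc]
        refine ⟨z, ⟨?_, (hKq' z).1 (by simpa using h1)⟩, rfl⟩
        push_cast at h2
        have : (q : ℤ) - p < z := by
          by_contra hcon
          push Not at hcon
          nlinarith
        omega
      have := Set.ncard_le_ncard hsub (Finset.finite_toSet _)
      rw [Set.ncard_coe_finset, Finset.card_image_of_injective _ (Prod.mk_right_injective 0),
        Nat.card_Ioc] at this
      omega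
    · rw [if_neg hc, ← hq, ← hQ] at hN
      have hpq1 : q < p := by rw [hpq] at hc; omega
      have hNb : N < b := by
        have h2 : (p : ℤ) ≤ Q := by exact_mod_cast hQp
        nlinarith
      have hsub : WSet a b K s j N ⊆ (((Finset.Icc 0 q).image (fun z => ((0 : ℕ), z)) ∪
          (Finset.Ioc (Q - (p - q - 1)) Q).image (fun z => ((1 : ℕ), z)) : Finset (ℕ × ℕ)) :
          Set (ℕ × ℕ)) := by
        rintro ⟨m, z⟩ ⟨h1, h2⟩
        simp only at h1 h2
        have hm : m < 2 := by
          by_contra hm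
          have := hm2 m z (by omega) h1
          omega
        simp only [Finset.coe_union, Set.mem_union, Finset.coe_image, Set.mem_image,
          Finset.coe_Icc, Finset.coe_Ioc, Set.mem_Icc, Set.mem_Ioc]
        interval_cases m
        · exact Or.inl ⟨z, ⟨Nat.zero_le _, (hKq' z).1 (by simpa using h1)⟩, rfl⟩
        · refine Or.inr ⟨z, ⟨?_, (hKQ' z).1 (by simpa using h1)⟩, rfl⟩
          push_cast at h2
          have : (Q : ℤ) - p + q + 1 < z := by
            by_contra hcon
            push Not at hcon
            nlinarith
          omega
      have := Set.ncard_le_ncard hsub (Finset.finite_toSet _)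
      rw [Set.ncard_coe_finset] at this
      have h3 := Finset.card_union_le ((Finset.Icc 0 q).image (fun z => ((0 : ℕ), z)))
        ((Finset.Ioc (Q - (p - q - 1)) Q).image (fun z => ((1 : ℕ), z)))
      rw [Finset.card_image_of_injective _ (Prod.mk_right_injective 0),
        Finset.card_image_of_injective _ (Prod.mk_right_injective 1),
        Nat.card_Icc, Nat.card_Ioc] at h3
      omega

theorem rep_eq_WSet {a b c K s j : ℕ} (N : ℤ) (hj : j < a) (hc : c + s * a = K * b)
    (hcop : Nat.Coprime a b) :
    repCount a b c ((j * b : ℕ) + a * N) = (WSet a b K s j N).ncard := by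
  have ha : (0 : ℤ) < a := by exact_mod_cast (by omega : 0 < a)
  have hcZ : (c : ℤ) = K * b - s * a := by
    have : (c : ℤ) + s * a = K * b := by exact_mod_cast hc
    linarith
  unfold repCount
  rw [← Nat.card_coe_set_eq]
  symm
  refine Nat.card_congr (Equiv.ofBijective (fun v : WSet a b K s j N =>
    ⟨((N - (((v.1.1 * b : ℕ) : ℤ) - ((s * v.1.2 : ℕ) : ℤ))).toNat, j + v.1.1 * a - K * v.1.2,
      v.1.2), ?_⟩) ⟨?_, ?_⟩)
  · obtain ⟨⟨m, z⟩, h1, h2⟩ := v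
    simp only at h1 h2 ⊢
    rw [Int.toNat_of_nonneg (by linarith), Nat.cast_sub h1, hcZ]
    push_cast
    ring
  · rintro ⟨⟨m, z⟩, h1, h2⟩ ⟨⟨m', z'⟩, h1', h2'⟩ h
    simp only [Subtype.mk.injEq, Prod.mk.injEq] at h h1 h2 h1' h2'
    obtain ⟨-, h4, rfl⟩ := h
    have : m * a = m' * a := by omega
    have hmm : m = m' := Nat.eq_of_mul_eq_mul_right (by omega) this
    exact Subtype.ext (Prod.ext hmm rfl)
  · rintro ⟨⟨x, y, z⟩, h⟩
    simp only at h
    have hdvd : (a : ℤ) ∣ ((y : ℤ) + K * z - j) := by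
      have h1 : (a : ℤ) ∣ b * ((y : ℤ) + K * z - j) := by
        refine ⟨N - x + s * z, ?_⟩
        rw [hcZ] at h
        push_cast at h
        linarith
      exact IsCoprime.dvd_of_dvd_mul_left (Nat.isCoprime_iff_coprime.2 hcop) h1
    obtain ⟨m, hm⟩ := hdvd
    have hm0 : 0 ≤ m := by
      by_contra hcon
      have h1 : m ≤ -1 := by omega
      have h2 : (j : ℤ) < a := by exact_mod_cast hj
      have h3 : (0 : ℤ) ≤ K * z := by positivity
      have h4 : (0 : ℤ) ≤ y := by positivity
      nlinarith
    lift m to ℕ using hm0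
    have hmN : y + K * z = j + m * a := by zify; linarith
    have hx : N - (((m * b : ℕ) : ℤ) - ((s * z : ℕ) : ℤ)) = x := by
      have : (a : ℤ) * (N - (((m * b : ℕ) : ℤ) - ((s * z : ℕ) : ℤ))) = a * x := by
        rw [hcZ] at h
        push_cast at h ⊢
        have hy : (y : ℤ) = j + a * m - K * z := by linarith
        rw [hy] at h
        linarith
      exact mul_left_cancel₀ ha.ne' this
    refine ⟨⟨(m, z), ?_, ?_⟩, ?_⟩
    · simp only; omega
    · simp only; omega
    · simp only [Subtype.mk.injEq, Prod.mk.injEq, and_true]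
      rw [hx]
      constructor
      · simp
      · omega

theorem sum_div_aux (K : ℕ) (hK : 1 ≤ K) (t : ℕ) : ∀ l ≤ K,
    2 * ∑ j ∈ Finset.range (t * K + l), ((j / K : ℕ) : ℤ) = K * t * (t - 1) + 2 * t * l := by
  induction t with
  | zero =>
    intro l hl
    rw [Finset.sum_eq_zero]
    · simp
    · intro j hj
      simp only [Finset.mem_range, zero_mul, zero_add] at hj
      rw [Nat.div_eq_of_lt (by omega)]; rfl
  | succ t ih =>
    intro l
    induction l with
    | zero =>
      intro _
      have := ih K le_rfl
      rw [show (t + 1) * K + 0 = t * K + K by ring, this]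
      push_cast
      ring
    | succ l ihl =>
      intro hl
      rw [← add_assoc, Finset.sum_range_succ, mul_add, ihl (by omega)]
      have : ((t + 1) * K + l) / K = t + 1 := by
        rw [mul_comm, Nat.mul_add_div hK, Nat.div_eq_of_lt (by omega), add_zero]
      rw [this]
      push_cast
      ring

theorem residue_bij {a b : ℕ} (hcop : Nat.Coprime a b) (ha : 0 < a) :
    Set.BijOn (fun j => j * b % a) (Finset.range a : Set ℕ) (Finset.range a : Set ℕ) := by
  have hmaps : Set.MapsTo (fun j => j * b % a) (Finset.range a : Set ℕ)
      (Finset.range a : Set ℕ) := fun j _ => by simpa using Nat.mod_lt _ ha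
  have hinj : Set.InjOn (fun j => j * b % a) (Finset.range a : Set ℕ) := by
    intro x hx y hy h
    simp only [Finset.coe_range, Set.mem_Iio] at hx hy
    have h1 : x * b ≡ y * b [MOD a] := h
    have h2 : x ≡ y [MOD a] := Nat.ModEq.cancel_right_of_coprime hcop h1
    exact Nat.ModEq.eq_of_lt_of_lt h2 hx hy
  exact ⟨hmaps, hinj, Finset.surjOn_of_injOn_of_card_le _ hmaps hinj le_rfl⟩

theorem sum_floor {a b : ℕ} (hcop : Nat.Coprime a b) (ha : 0 < a) :
    2 * ∑ j ∈ Finset.range a, ((j * b / a : ℕ) : ℤ) = (a - 1) * (b - 1) := by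
  have hb := residue_bij hcop ha
  have h1 : ∑ j ∈ Finset.range a, ((j * b % a : ℕ) : ℤ) = ∑ j ∈ Finset.range a, (j : ℤ) := by
    refine Finset.sum_bij (fun j _ => j * b % a) (fun j hj => hb.1 hj)
      (fun x hx y hy h => hb.2.1 hx hy h) (fun y hy => ?_) (fun _ _ => rfl)
    obtain ⟨x, hx, hxy⟩ := hb.2.2 hy
    exact ⟨x, hx, hxy⟩
  have h2 : ∑ j ∈ Finset.range a, (j : ℤ) * 2 = a * (a - 1) := by
    have := Finset.sum_range_id_mul_two a
    zify at this
    rw [Nat.cast_sub ha] at this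
    rw [← Finset.sum_mul]
    exact_mod_cast this
  have h3 : ∑ j ∈ Finset.range a, ((j * b % a : ℕ) : ℤ) +
      a * ∑ j ∈ Finset.range a, ((j * b / a : ℕ) : ℤ) = b * ∑ j ∈ Finset.range a, (j : ℤ) := by
    rw [Finset.mul_sum, Finset.mul_sum, ← Finset.sum_add_distrib]
    refine Finset.sum_congr rfl fun j _ => ?_
    have := Nat.mod_add_div (j * b) a
    rw [mul_comm (b : ℤ)]
    exact_mod_cast this
  rw [h1] at h3
  rw [← Finset.sum_mul] at h2
  have ha' : (a : ℤ) ≠ 0 := by exact_mod_cast ha.ne'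
  apply mul_left_cancel₀ ha'
  linear_combination 2 * h3 + (b - 1) * h2

theorem thr_nonneg {a b K s p j : ℕ} (hs : 2 * s ≤ K) (hs1 : 1 ≤ s) (hj : j < a)
    (hab : 3 * a ≤ 2 * b) (hp : p * K < a) : 0 ≤ thr a b K s p j + ((j * b / a : ℕ) : ℤ) := by
  have hK : 1 ≤ K := by omega
  have h1 : s * (j / K) ≤ j * b / a := by
    rw [Nat.le_div_iff_mul_le (by omega)]
    have h2 : K * (j / K) ≤ j := Nat.mul_div_le j K
    have h3 : 2 * s * (j / K) ≤ K * (j / K) := Nat.mul_le_mul_right _ hs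
    have h4 : s * (j / K) ≤ j := by nlinarith
    calc _ ≤ j * a := Nat.mul_le_mul_right _ h4
      _ ≤ j * b := Nat.mul_le_mul_left _ (by omega)
  have h1' : (s : ℤ) * ((j / K : ℕ) : ℤ) ≤ ((j * b / a : ℕ) : ℤ) := by exact_mod_cast h1
  unfold thr
  split_ifs with hc
  · have : (0 : ℤ) ≤ s * p := by positivity
    linarith
  · have hq : j / K < p := by rw [Nat.div_lt_iff_lt_mul hK]; omega
    have hQb := bound_sz (m := 1) (z := (j + a) / K) hs hj (by
      rw [one_mul]; exact Nat.mul_div_le _ K)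
    have h5 : (s : ℤ) * (((j + a) / K : ℕ) : ℤ) < b := by
      exact_mod_cast (by omega : s * ((j + a) / K) < b)
    have h6 : ((j / K : ℕ) : ℤ) + 1 ≤ p := by exact_mod_cast hq
    have h7 : (0 : ℤ) ≤ ((j * b / a : ℕ) : ℤ) := by positivity
    have h8 : (0 : ℤ) ≤ s := by positivity
    nlinarith

theorem sum_thr {a b K s p : ℕ} (hK : 1 ≤ K) (hp : p * K < a) :
    2 * ∑ j ∈ Finset.range a, thr a b K s p j =
      2 * p * K * b - s * (2 * (((a - 1) / K : ℕ) : ℤ) * a -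
        ((((a - 1) / K : ℕ) : ℤ) + p + 1) * ((((a - 1) / K : ℕ) : ℤ) - p) * K) := by
  have h1 : ∀ j, thr a b K s p j = -(s : ℤ) * ((j / K : ℕ) : ℤ) + s * p +
      (if j < p * K then (b : ℤ) - s * ((((j + a) / K : ℕ) : ℤ) + 1) else 0) := by
    intro j
    unfold thr
    by_cases hc : p * K ≤ j
    · rw [if_pos hc, if_neg (by omega)]; ring
    · rw [if_neg hc, if_pos (by omega)]; ring
  have h2 : ∑ j ∈ Finset.range a, (if j < p * K then
      (b : ℤ) - s * ((((j + a) / K : ℕ) : ℤ) + 1) else 0) =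
      ∑ j ∈ Finset.range (p * K), ((b : ℤ) - s * ((((j + a) / K : ℕ) : ℤ) + 1)) := by
    rw [← Finset.sum_filter]
    congr 1
    ext j
    simp only [Finset.mem_filter, Finset.mem_range]
    omega
  simp_rw [h1]
  rw [Finset.sum_add_distrib, h2, Finset.sum_add_distrib, Finset.sum_sub_distrib,
    ← Finset.mul_sum, ← Finset.mul_sum, ← Finset.mul_sum, Finset.sum_add_distrib]
  simp only [Finset.sum_const, Finset.card_range, nsmul_eq_mul, mul_one]
  have h3 : ∑ j ∈ Finset.range (a + p * K), ((j / K : ℕ) : ℤ) =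
      ∑ j ∈ Finset.range a, ((j / K : ℕ) : ℤ) +
      ∑ j ∈ Finset.range (p * K), (((j + a) / K : ℕ) : ℤ) := by
    rw [Finset.sum_range_add]
    simp_rw [add_comm a]
  set r := (a - 1) / K with hr
  have hr1 : r * K ≤ a - 1 := Nat.div_mul_le_self _ _
  have hr2 : a - 1 < (r + 1) * K := by
    rw [add_mul, one_mul]; exact Nat.lt_div_mul_add hK
  have hl : a - r * K ≤ K := by rw [add_mul] at hr2; omega
  have h4 := sum_div_aux K hK (r + p) (a - r * K) hl
  rw [show (r + p) * K + (a - r * K) = a + p * K by rw [add_mul]; omega, h3,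
    Nat.cast_sub (by omega)] at h4
  push_cast at h4 ⊢
  linear_combination (-(s : ℤ)) * h4

theorem count_main {a b c K s p : ℕ} (hs : 2 * s ≤ K) (hs1 : 1 ≤ s)
    (hab : 3 * a ≤ 2 * b) (hp : p * K < a) (hc : c + s * a = K * b)
    (hcop : Nat.Coprime a b) :
    (Nat.card {n : ℕ | repCount a b c (n : ℤ) ≤ p} : ℤ) =
      ∑ j ∈ Finset.range a, (thr a b K s p j + ((j * b / a : ℕ) : ℤ)) := by
  have ha : 0 < a := by omega
  have hbij := residue_bij hcop ha
  have hkey : ∀ j < a, ∀ u : ℕ, repCount a b c ((j * b % a + a * u : ℕ) : ℤ) ≤ p ↔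
      u < (thr a b K s p j + ((j * b / a : ℕ) : ℤ)).toNat := by
    intro j hj u
    have h0 : ((j * b % a + a * u : ℕ) : ℤ) =
        ((j * b : ℕ) : ℤ) + a * ((u : ℤ) - ((j * b / a : ℕ) : ℤ)) := by
      have := Nat.mod_add_div (j * b) a
      zify at this
      push_cast
      linarith
    rw [h0, rep_eq_WSet _ hj hc hcop, WSet_card _ hs hs1 hj hab hp, Int.lt_toNat]
    omega
  set D := (Finset.range a).sigma
    (fun j => Finset.range (thr a b K s p j + ((j * b / a : ℕ) : ℤ)).toNat) with hD
  have hcard : Nat.card {n : ℕ | repCount a b c (n : ℤ) ≤ p} = D.card := by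
    rw [← Nat.card_eq_finsetCard]
    symm
    refine Nat.card_congr (Equiv.ofBijective
      (fun v : D => ⟨v.1.1 * b % a + a * v.1.2, ?_⟩) ⟨?_, ?_⟩)
    · obtain ⟨⟨j, u⟩, h⟩ := v
      simp only [hD, Finset.mem_sigma, Finset.mem_range] at h
      exact (hkey j h.1 u).2 h.2
    · rintro ⟨⟨j, u⟩, h⟩ ⟨⟨j', u'⟩, h'⟩ he
      simp only [Subtype.mk.injEq] at he
      simp only [hD, Finset.mem_sigma, Finset.mem_range] at h h'
      have e1 : j * b % a = j' * b % a := by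
        have := congrArg (· % a) he
        simpa using this
      have e2 : j = j' := hbij.2.1 (by simpa using h.1) (by simpa using h'.1) e1
      subst e2
      have e3 : u = u' := by
        have : a * u = a * u' := by omega
        exact Nat.eq_of_mul_eq_mul_left ha this
      subst e3
      rfl
    · rintro ⟨n, hn⟩
      obtain ⟨j, hj, hjn⟩ := hbij.2.2 (show n % a ∈ (Finset.range a : Set ℕ) by
        simpa using Nat.mod_lt n ha)
      simp only [Finset.coe_range, Set.mem_Iio] at hj hjn
      have hn' : j * b % a + a * (n / a) = n := by rw [hjn]; exact Nat.mod_add_div n a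
      refine ⟨⟨⟨j, n / a⟩, ?_⟩, ?_⟩
      · simp only [hD, Finset.mem_sigma, Finset.mem_range]
        refine ⟨hj, (hkey j hj _).1 ?_⟩
        rw [hn']; exact hn
      · simp only [Subtype.mk.injEq]
        exact hn'
  rw [hcard, hD, Finset.card_sigma]
  push_cast [Finset.card_range]
  refine Finset.sum_congr rfl fun j hj => ?_
  have := thr_nonneg (p := p) hs hs1 (Finset.mem_range.1 hj) hab hp
  push_cast at this
  exact Int.toNat_of_nonneg this

theorem fib_rel (i k : ℕ) (hk : 3 ≤ k) :
    Nat.fib (i + k) + Nat.fib (k - 2) * Nat.fib i = Nat.fib k * Nat.fib (i + 2) := by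
  obtain ⟨t, rfl⟩ := Nat.exists_eq_add_of_le hk
  have h1 : Nat.fib (i + (3 + t)) = Nat.fib i * Nat.fib (t + 2) +
      Nat.fib (i + 1) * Nat.fib (t + 3) := by
    rw [show i + (3 + t) = i + (t + 2) + 1 by ring, Nat.fib_add]
  rw [h1, show 3 + t - 2 = t + 1 by omega, show 3 + t = t + 3 by ring,
    Nat.fib_add_two (n := i), Nat.fib_add_two (n := t + 1)]
  ring


theorem stmt16 (i k p : ℕ) (hi : 3 ≤ i) (hk : 3 ≤ k)
    (hr : p ≤ (Nat.fib i - 1) / Nat.fib k) :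
    letI F := Nat.fib
    letI r := (F i - 1) / F k
    (Nat.card {n : ℕ | repCount (F i) (F (i + 2)) (F (i + k)) (n : ℤ) ≤ p} : ℚ) =
      (((F i : ℚ) + 2 * p * F k - 1) * F (i + 2) - F i + 1) / 2 -
        (2 * (r : ℚ) * F i - ((r : ℚ) + p + 1) * ((r : ℚ) - p) * F k) * F (k - 2) / 2 := by
  set F := Nat.fib with hF
  set r := (F i - 1) / F k with hrr
  have ha : 0 < Nat.fib i := Nat.fib_pos.2 (by omega)
  have hs1 : 1 ≤ Nat.fib (k - 2) := Nat.fib_pos.2 (by omega)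
  have hs : 2 * Nat.fib (k - 2) ≤ Nat.fib k := by
    obtain ⟨t, rfl⟩ := Nat.exists_eq_add_of_le hk
    rw [show 3 + t - 2 = t + 1 by omega, show 3 + t = (t + 1) + 2 by ring,
      Nat.fib_add_two (n := t + 1)]
    have := Nat.fib_le_fib_succ (n := t + 1)
    omega
  have hab : 3 * Nat.fib i ≤ 2 * Nat.fib (i + 2) := by
    rw [Nat.fib_add_two (n := i)]
    have := Nat.fib_le_fib_succ (n := i)
    omega
  have hp : p * Nat.fib k < Nat.fib i := by
    have : p * Nat.fib k ≤ Nat.fib i - 1 :=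
      (Nat.le_div_iff_mul_le (by omega : 0 < Nat.fib k)).1 hr
    omega
  have hcop : Nat.Coprime (Nat.fib i) (Nat.fib (i + 2)) := by
    rw [Nat.fib_add_two (n := i)]
    simpa using Nat.fib_coprime_fib_succ i
  have h1 := count_main hs hs1 hab hp (fib_rel i k hk) hcop
  rw [Finset.sum_add_distrib] at h1
  have h2 := sum_thr (b := Nat.fib (i + 2)) (s := Nat.fib (k - 2))
    (by omega : 1 ≤ Nat.fib k) hp
  have h3 := sum_floor hcop ha
  have h4 : 2 * (Nat.card {n : ℕ | repCount (F i) (F (i + 2)) (F (i + k)) (n : ℤ) ≤ p} : ℤ) =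
      2 * p * F k * F (i + 2) - F (k - 2) * (2 * (r : ℤ) * F i -
        ((r : ℤ) + p + 1) * ((r : ℤ) - p) * F k) + (F i - 1) * (F (i + 2) - 1) := by
    linear_combination 2 * h1 + h2 + h3
  have h5 : 2 * (Nat.card {n : ℕ | repCount (F i) (F (i + 2)) (F (i + k)) (n : ℤ) ≤ p} : ℚ) =
      2 * p * F k * F (i + 2) - F (k - 2) * (2 * (r : ℚ) * F i -
        ((r : ℚ) + p + 1) * ((r : ℚ) - p) * F k) + (F i - 1) * (F (i + 2) - 1) := by
    exact_mod_cast h4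
  linear_combination h5 / 2
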